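/- arXiv:1801.00921 — 2 statements merged into one kernel-verified Lean document; each statement's English description precedes it below -/
import Mathlib

section
/- Let A, B, C be multiplicative characters on F_q with B ≠ ε, A ≠ B, B ≠ C and C ≠ A, and let x, y ∈ F_q^× with x ≠ 1 and y ≠ 1. Then F₄*(A; B; C, B; -x/((1-x)(1-y)), -y/((1-x)(1-y))) = A((1-x)(1-y)) · F₁*(A; B̄C, AC̄; C; x, xy) - [g(B)g(AB̄)/(q·g(A))] · B̄(y) · B((1-x)(1-y)). -/
/-- Multiplicative characters of a finite field with values in `ℂ` form a finite type. -/
noncomputable instance mulCharFintypeC (F : Type*) [Field F] [Fintype F] :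
    Fintype (MulChar F ℂ) :=
  Fintype.ofFinite _

/-- The canonical additive character `θ(α) = ζ^{tr(α)}` of a finite field `F` of
characteristic `p`, where `ζ` is a fixed primitive `p`-th root of unity in `ℂ`
and `tr` is the trace map to `ZMod p = F_p`. -/
noncomputable def addCharTheta (p : ℕ) (F : Type*) [Field F] [Fintype F]
    [Algebra (ZMod p) F] (zeta : ℂ) (a : F) : ℂ :=
  zeta ^ (Algebra.trace (ZMod p) F a).val

/-- The Gauss sum `g(χ) = ∑_{x ∈ F} χ(x) θ(x)`. -/
noncomputable def gaussS (p : ℕ) (F : Type*) [Field F] [Fintype F]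
    [Algebra (ZMod p) F] (zeta : ℂ) (χ : MulChar F ℂ) : ℂ :=
  ∑ x : F, χ x * addCharTheta p F zeta x

/-- McCarthy's finite field hypergeometric function
`₂F₁*(A₀, A₁; B₁ | x) = (1/(q-1)) ∑_χ [g(A₀χ)g(A₁χ)g((B₁χ)⁻¹)g(χ⁻¹)/(g(A₀)g(A₁)g(B₁⁻¹))] χ(x)`. -/
noncomputable def mcCarthy2F1 (p : ℕ) (F : Type*) [Field F] [Fintype F]
    [Algebra (ZMod p) F] (zeta : ℂ) (A₀ A₁ B₁ : MulChar F ℂ) (x : F) : ℂ :=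
  (1 / ((Fintype.card F : ℂ) - 1)) * ∑ χ : MulChar F ℂ,
    gaussS p F zeta (A₀ * χ) * gaussS p F zeta (A₁ * χ) * gaussS p F zeta (B₁ * χ)⁻¹ *
      gaussS p F zeta χ⁻¹ /
        (gaussS p F zeta A₀ * gaussS p F zeta A₁ * gaussS p F zeta B₁⁻¹) * χ x

/-- The finite field Appell function `F₄*(A; B; C, C'; x, y)`. -/
noncomputable def appellF4star (p : ℕ) (F : Type*) [Field F] [Fintype F]
    [Algebra (ZMod p) F] (zeta : ℂ) (A B C C' : MulChar F ℂ) (x y : F) : ℂ :=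
  (1 / ((Fintype.card F : ℂ) - 1) ^ 2) * ∑ ψ : MulChar F ℂ, ∑ χ : MulChar F ℂ,
    gaussS p F zeta (A * χ * ψ) * gaussS p F zeta (B * χ * ψ) * gaussS p F zeta (C * ψ)⁻¹ *
      gaussS p F zeta (C' * χ)⁻¹ * gaussS p F zeta ψ⁻¹ * gaussS p F zeta χ⁻¹ /
        (gaussS p F zeta A * gaussS p F zeta B * gaussS p F zeta C⁻¹ *
          gaussS p F zeta C'⁻¹) *
      (ψ x * χ y)

/-- The finite field Appell function `F₁*(A; B, B'; C; x, y)`. -/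
noncomputable def appellF1star (p : ℕ) (F : Type*) [Field F] [Fintype F]
    [Algebra (ZMod p) F] (zeta : ℂ) (A B B' C : MulChar F ℂ) (x y : F) : ℂ :=
  (1 / ((Fintype.card F : ℂ) - 1) ^ 2) * ∑ ψ : MulChar F ℂ, ∑ χ : MulChar F ℂ,
    gaussS p F zeta (A * χ * ψ) * gaussS p F zeta (B * ψ) * gaussS p F zeta (B' * χ) *
      gaussS p F zeta (C * χ * ψ)⁻¹ * gaussS p F zeta ψ⁻¹ * gaussS p F zeta χ⁻¹ /
        (gaussS p F zeta A * gaussS p F zeta B * gaussS p F zeta B' *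
          gaussS p F zeta C⁻¹) *
      (ψ x * χ y)

/-- The Jacobi sum `J(A,B) = ∑_{x ∈ F} A(x) B(1-x)`. -/
noncomputable def jacobiS (F : Type*) [Field F] [Fintype F] (A B : MulChar F ℂ) : ℂ :=
  ∑ x : F, A x * B (1 - x)

/-- Greene's binomial coefficient `(A choose B) = (B(-1)/q) J(A, B⁻¹)`. -/
noncomputable def binomChar (F : Type*) [Field F] [Fintype F] (A B : MulChar F ℂ) : ℂ :=
  (B (-1) / (Fintype.card F : ℂ)) * jacobiS F A B⁻¹

section AppellLemmas

lemma inv_mulChar_apply {F : Type*} [Field F] (χ : MulChar F ℂ) (a : F) : χ⁻¹ a = (χ a)⁻¹ := by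
  rw [MulChar.inv_apply_eq_inv, Ring.inverse_eq_inv']

lemma mulChar_units_ne_zero {F : Type*} [Field F] (χ : MulChar F ℂ) (u : Fˣ) : χ u ≠ 0 :=
  (u.isUnit.map χ).ne_zero

variable {F : Type*} [Field F] [Fintype F] [DecidableEq F]

lemma sum_eq_sum_units_of_zero {f : F → ℂ} (hf : f 0 = 0) :
    ∑ a : F, f a = ∑ u : Fˣ, f u := by
  rw [← Finset.add_sum_erase _ _ (Finset.mem_univ (0 : F)), hf, zero_add]
  symm
  refine Finset.sum_bij (fun u _ ↦ (u : F)) ?_ ?_ ?_ ?_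
  · intro u _
    simp
  · intro u _ v _ h
    exact Units.ext h
  · intro b hb
    exact ⟨Units.mk0 b (Finset.ne_of_mem_erase hb), Finset.mem_univ _, rfl⟩
  · intro u _
    rfl

lemma gaussSum_eq_sum_units (χ : MulChar F ℂ) (θ : AddChar F ℂ) :
    gaussSum χ θ = ∑ u : Fˣ, χ u * θ u :=
  sum_eq_sum_units_of_zero (by simp [MulChar.map_zero])

/-- Orthogonality of the multiplicative characters of a finite field. -/
lemma sum_mulChar_apply_units (u : Fˣ) :
    ∑ χ : MulChar F ℂ, χ u = if u = 1 then (Fintype.card F : ℂ) - 1 else 0 := by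
  split_ifs with hu
  · have h := MulChar.card_eq_card_units_of_hasEnoughRootsOfUnity F ℂ
    rw [Nat.card_eq_fintype_card, Nat.card_eq_fintype_card, Fintype.card_units] at h
    simp [hu, h, Nat.cast_sub Fintype.card_pos]
  · obtain ⟨χ, hχ⟩ := MulChar.exists_apply_ne_one_of_hasEnoughRootsOfUnity F ℂ
      (a := (u : F)) (by simpa using hu)
    refine eq_zero_of_mul_eq_self_left hχ ?_
    simp only [Finset.mul_sum, ← MulChar.mul_apply]
    exact Fintype.sum_bijective _ (Group.mulLeft_bijective χ) _ _ fun χ' ↦ rfl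

/-- The inverse Mellin transform of a product is a multiplicative convolution. -/
lemma sum_mulChar_mul_mul (f h : Fˣ → ℂ) (z : Fˣ) :
    ∑ ψ : MulChar F ℂ, (∑ u : Fˣ, ψ⁻¹ u * f u) * (∑ v : Fˣ, ψ⁻¹ v * h v) * ψ z =
      ((Fintype.card F : ℂ) - 1) * ∑ u : Fˣ, f u * h (u⁻¹ * z) := by
  calc _ = ∑ ψ : MulChar F ℂ, ∑ u : Fˣ, ∑ v : Fˣ,
        f u * h v * ψ ((u⁻¹ * v⁻¹ * z : Fˣ) : F) := by
        refine Finset.sum_congr rfl fun ψ _ ↦ ?_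
        rw [Finset.sum_mul_sum, Finset.sum_mul]
        refine Finset.sum_congr rfl fun u _ ↦ ?_
        rw [Finset.sum_mul]
        refine Finset.sum_congr rfl fun v _ ↦ ?_
        simp only [Units.val_mul, map_mul, MulChar.inv_apply, Ring.inverse_unit]
        ring
    _ = ∑ u : Fˣ, ∑ v : Fˣ, f u * h v *
          (if u⁻¹ * v⁻¹ * z = 1 then (Fintype.card F : ℂ) - 1 else 0) := by
        rw [Finset.sum_comm]
        refine Finset.sum_congr rfl fun u _ ↦ ?_
        rw [Finset.sum_comm]
        refine Finset.sum_congr rfl fun v _ ↦ ?_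
        rw [← Finset.mul_sum, sum_mulChar_apply_units]
    _ = _ := by
        rw [Finset.mul_sum]
        refine Finset.sum_congr rfl fun u _ ↦ ?_
        rw [Finset.sum_eq_single (u⁻¹ * z)]
        · simp
          ring
        · intro v _ hv
          rw [if_neg, mul_zero]
          intro h1
          apply hv
          rw [mul_right_comm, mul_inv_eq_one] at h1
          exact h1.symm
        · simp

/-- A Gauss sum with a dilated additive character; the dilation may be zero. -/
lemma sum_units_mulChar_mul_addChar (χ : MulChar F ℂ) (hχ : χ ≠ 1) (θ : AddChar F ℂ) (z : F) :
    ∑ u : Fˣ, χ u * θ (u * z) = gaussSum χ θ * χ⁻¹ z := by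
  rcases eq_or_ne z 0 with rfl | hz
  · rw [← sum_eq_sum_units_of_zero (f := fun a ↦ χ a * θ (a * 0)) (by simp [MulChar.map_zero])]
    simpa [MulChar.map_zero] using MulChar.sum_eq_zero_of_ne_one hχ
  · have h := gaussSum_mulShift_eq χ θ (Units.mk0 z hz)
    rw [gaussSum_eq_sum_units χ (AddChar.mulShift _ _)] at h
    simpa [AddChar.mulShift_apply, mul_comm] using h

lemma sum_gaussSum_mul_gaussSum_inv (B : MulChar F ℂ) (hB : B ≠ 1) (θ : AddChar F ℂ) (z : Fˣ) :
    ∑ ψ : MulChar F ℂ, gaussSum (B * ψ) θ * gaussSum ψ⁻¹ θ * ψ z =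
      ((Fintype.card F : ℂ) - 1) * (gaussSum B θ * B⁻¹ (1 + z)) := by
  rw [← sum_units_mulChar_mul_addChar B hB]
  have h := sum_mulChar_mul_mul (fun u : Fˣ ↦ B⁻¹ u * θ (u⁻¹ : Fˣ)) (fun u : Fˣ ↦ θ u) z
  rw [← Equiv.sum_comp (Equiv.inv Fˣ) (fun u : Fˣ ↦ B u * θ (u * (1 + z)))]
  convert! h using 3 with ψ _ u
  · rw [gaussSum_eq_sum_units, gaussSum_eq_sum_units,
      ← Equiv.sum_comp (Equiv.inv Fˣ)]
    congr 2
    ext u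
    simp [MulChar.inv_apply']
    ring
  · simp [MulChar.inv_apply', mul_add, AddChar.map_add_eq_mul]
    ring

lemma sum_gaussSum_inv_mul_gaussSum_inv (C : MulChar F ℂ) (θ : AddChar F ℂ) (z : Fˣ) :
    ∑ ψ : MulChar F ℂ, gaussSum (C * ψ)⁻¹ θ * gaussSum ψ⁻¹ θ * ψ z =
      ((Fintype.card F : ℂ) - 1) * ∑ c : Fˣ, C⁻¹ c * θ (c + (c⁻¹ * z : Fˣ)) := by
  have h := sum_mulChar_mul_mul (fun u : Fˣ ↦ C⁻¹ u * θ u) (fun u : Fˣ ↦ θ u) z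
  convert! h using 3 with ψ _ u
  · rw [gaussSum_eq_sum_units, gaussSum_eq_sum_units]
    congr 2
    ext u
    simp only [mul_inv, MulChar.mul_apply]
    ring
  · rw [AddChar.map_add_eq_mul]
    ring

omit [DecidableEq F] in
lemma sum_sum_mulChar_separate {ι : Type*} [Fintype ι] (w : ι → ℂ) (z z' : ι → Fˣ)
    (f g : MulChar F ℂ → ℂ) :
    ∑ ψ : MulChar F ℂ, ∑ χ : MulChar F ℂ,
        (∑ i, w i * (ψ (z i) * χ (z' i))) * (f ψ * g χ) =
      ∑ i, w i * ((∑ ψ : MulChar F ℂ, f ψ * ψ (z i)) * ∑ χ : MulChar F ℂ, g χ * χ (z' i)) := by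
  calc _ = ∑ ψ : MulChar F ℂ, ∑ χ : MulChar F ℂ, ∑ i,
        w i * ((f ψ * ψ (z i)) * (g χ * χ (z' i))) := by
        refine Finset.sum_congr rfl fun ψ _ ↦ Finset.sum_congr rfl fun χ _ ↦ ?_
        rw [Finset.sum_mul]
        exact Finset.sum_congr rfl fun i _ ↦ by ring
    _ = _ := by
        simp_rw [Finset.sum_mul_sum, Finset.mul_sum]
        rw [Finset.sum_comm]
        simp_rw [Finset.sum_comm (γ := ι)]
        rw [Finset.sum_comm]

/-- The double character sum defining `F₁*`, as a finite field Euler integral. -/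
lemma sum_appellF1_eq (A B B' C : MulChar F ℂ) (hB : B ≠ 1) (hB' : B' ≠ 1) (hAC : A * C⁻¹ ≠ 1)
    (θ : AddChar F ℂ) (x y : Fˣ) :
    ∑ ψ : MulChar F ℂ, ∑ χ : MulChar F ℂ,
      gaussSum (A * χ * ψ) θ * gaussSum (B * ψ) θ * gaussSum (B' * χ) θ *
        gaussSum (C * χ * ψ)⁻¹ θ * gaussSum ψ⁻¹ θ * gaussSum χ⁻¹ θ * (ψ x * χ y) =
    ((Fintype.card F : ℂ) - 1) ^ 2 * (gaussSum B θ * gaussSum B' θ * gaussSum (A * C⁻¹) θ *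
      ∑ w : Fˣ, A w * (A * C⁻¹)⁻¹ (1 + w) * B⁻¹ (1 + x * w) * B'⁻¹ (1 + y * w)) := by
  have h := sum_sum_mulChar_separate
    (fun i : Fˣ × Fˣ ↦ A i.1 * θ i.1 * (C⁻¹ i.2 * θ i.2))
    (fun i ↦ i.1 * i.2⁻¹ * x) (fun i ↦ i.1 * i.2⁻¹ * y)
    (fun ψ : MulChar F ℂ ↦ gaussSum (B * ψ) θ * gaussSum ψ⁻¹ θ)
    (fun ψ : MulChar F ℂ ↦ gaussSum (B' * ψ) θ * gaussSum ψ⁻¹ θ)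
  simp only [sum_gaussSum_mul_gaussSum_inv B hB, sum_gaussSum_mul_gaussSum_inv B' hB'] at h
  calc _ = _ := by
        refine Finset.sum_congr rfl fun ψ _ ↦ Finset.sum_congr rfl fun χ _ ↦ ?_
        have e : ∑ i : Fˣ × Fˣ, A i.1 * θ i.1 * (C⁻¹ i.2 * θ i.2) *
            (ψ (i.1 * i.2⁻¹ * x : Fˣ) * χ (i.1 * i.2⁻¹ * y : Fˣ)) =
            gaussSum (A * χ * ψ) θ * gaussSum (C * χ * ψ)⁻¹ θ * (ψ x * χ y) := by
          rw [gaussSum_eq_sum_units, gaussSum_eq_sum_units, Finset.sum_mul_sum,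
            Fintype.sum_prod_type, Finset.sum_mul]
          refine Finset.sum_congr rfl fun u _ ↦ ?_
          rw [Finset.sum_mul]
          refine Finset.sum_congr rfl fun v _ ↦ ?_
          simp only [Units.val_mul, map_mul, mul_inv, MulChar.mul_apply, MulChar.inv_apply,
            Ring.inverse_unit]
          ring
        refine Eq.trans ?_ (congrArg (· * ((gaussSum (B * ψ) θ * gaussSum ψ⁻¹ θ) *
          (gaussSum (B' * χ) θ * gaussSum χ⁻¹ θ))) e.symm)
        ring
    _ = _ := h
    _ = ∑ v : Fˣ, ∑ w : Fˣ, ((Fintype.card F : ℂ) - 1) ^ 2 * (gaussSum B θ * gaussSum B' θ) *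
          (A w * B⁻¹ (1 + x * w) * B'⁻¹ (1 + y * w)) *
            ((A * C⁻¹) v * θ (v * (1 + w))) := by
        rw [Fintype.sum_prod_type, Finset.sum_comm]
        refine Finset.sum_congr rfl fun v _ ↦ ?_
        rw [← Equiv.sum_comp (Equiv.mulLeft v)]
        refine Finset.sum_congr rfl fun w _ ↦ ?_
        simp only [Equiv.coe_mulLeft, mul_inv_cancel_comm, Units.val_mul, map_mul, mul_add,
          mul_one, AddChar.map_add_eq_mul, MulChar.mul_apply, mul_comm (w : F)]
        ring
    _ = _ := by
        rw [Finset.sum_comm, Finset.mul_sum, Finset.mul_sum]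
        refine Finset.sum_congr rfl fun w _ ↦ ?_
        rw [← Finset.mul_sum, sum_units_mulChar_mul_addChar _ hAC]
        ring

lemma sum_units_addChar {θ : AddChar F ℂ} (hθ : θ.IsPrimitive) (z : F) :
    ∑ u : Fˣ, θ (u * z) = (if z = 0 then (Fintype.card F : ℂ) else 0) - 1 := by
  have h := AddChar.sum_mulShift z hθ
  rw [← sub_add_cancel (∑ a : F, θ (a * z)) 1, add_comm, ← eq_sub_iff_add_eq'] at h
  have e := sum_eq_sum_units_of_zero (f := fun a : F ↦ θ (a * z) - if a = 0 then 1 else 0)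
    (by simp)
  rw [Finset.sum_sub_distrib] at e
  simp at e h
  rw [← e, h]

lemma sum_units_mul_ite (B : MulChar F ℂ) (H : F → ℂ) (r : F) :
    ∑ t : Fˣ, B t * H t * (if 1 + t + t * r = 0 then (Fintype.card F : ℂ) else 0) =
      Fintype.card F * (B⁻¹ (-(1 + r)) * H (-(1 + r)⁻¹)) := by
  rcases eq_or_ne (1 + r) 0 with hr | hr
  · rw [hr, neg_zero, MulChar.map_zero, zero_mul, mul_zero]
    refine Finset.sum_eq_zero fun t _ ↦ ?_
    rw [if_neg, mul_zero]
    rw [show 1 + (t : F) + t * r = 1 + t * (1 + r) by ring, hr]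
    simp
  · have ht : -(1 + r)⁻¹ ≠ 0 := by simpa using hr
    rw [Finset.sum_eq_single (Units.mk0 _ ht)]
    · rw [if_pos, MulChar.inv_apply', inv_neg]
      · simp only [Units.val_mk0]
        ring
      · simp only [Units.val_mk0]
        field_simp
        ring
    · intro t _ hne
      rw [if_neg, mul_zero]
      intro h
      apply hne
      ext
      rw [Units.val_mk0, eq_comm, neg_eq_iff_eq_neg, inv_eq_iff_eq_inv, inv_neg]
      field_simp
      linear_combination h
    · simp

lemma sum_units_quadruple_dilate (S : Fˣ → Fˣ → Fˣ → Fˣ → ℂ) :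
    ∑ a, ∑ b, ∑ c, ∑ e, S a b c e = ∑ w, ∑ t, ∑ c, ∑ e, S (c * w) (e * t) c e := by
  simp only [← Fintype.sum_prod_type']
  symm
  refine Finset.sum_bij' (fun i _ ↦ (i.2.2.1 * i.1, i.2.2.2 * i.2.1, i.2.2.1, i.2.2.2))
    (fun i _ ↦ (i.2.2.1⁻¹ * i.1, i.2.2.2⁻¹ * i.2.1, i.2.2.1, i.2.2.2)) ?_ ?_ ?_ ?_ ?_ <;> simp

/-- The Gauss sum contribution responsible for the correction term. -/
lemma sum_units_triple_eq (A B C : MulChar F ℂ) (hB : B ≠ 1) (θ : AddChar F ℂ) (Y : F) :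
    ∑ w : Fˣ, ∑ t : Fˣ, ∑ c : Fˣ,
      A w * B t * ((A * C⁻¹) c * θ (c * (1 + w + w * t * Y))) =
    gaussSum C⁻¹ θ * gaussSum (A * B⁻¹) θ * (gaussSum B θ * B⁻¹ Y) := by
  have e : ∀ S : Fˣ → Fˣ → Fˣ → ℂ, ∑ w, ∑ t, ∑ c, S w t c =
      ∑ c, ∑ a, ∑ s, S (c⁻¹ * a) (a⁻¹ * s) c := by
    intro S
    simp only [← Fintype.sum_prod_type']
    refine Finset.sum_bij' (fun i _ ↦ (i.2.2, i.2.2 * i.1, i.2.2 * i.1 * i.2.1))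
      (fun i _ ↦ (i.1⁻¹ * i.2.1, i.2.1⁻¹ * i.2.2, i.1)) ?_ ?_ ?_ ?_ ?_ <;> simp [mul_assoc]
  rw [e, ← sum_units_mulChar_mul_addChar B hB, gaussSum_eq_sum_units C⁻¹,
    gaussSum_eq_sum_units (A * B⁻¹), Finset.sum_mul_sum, Finset.sum_mul]
  refine Finset.sum_congr rfl fun c _ ↦ ?_
  rw [Finset.sum_mul]
  refine Finset.sum_congr rfl fun a _ ↦ ?_
  rw [Finset.mul_sum]
  refine Finset.sum_congr rfl fun s _ ↦ ?_
  have h : (c : F) * (1 + (c⁻¹ * a : Fˣ) + (c⁻¹ * a : Fˣ) * (a⁻¹ * s : Fˣ) * Y) =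
      c + a + s * Y := by
    simp only [Units.val_mul, Units.val_inv_eq_inv_val]
    field_simp
  rw [h]
  have hA := mulChar_units_ne_zero A c
  have hB := mulChar_units_ne_zero B a
  simp only [AddChar.map_add_eq_mul, Units.val_mul, Units.val_inv_eq_inv_val, map_mul,
    MulChar.mul_apply, ← MulChar.inv_apply']
  simp only [inv_mulChar_apply]
  field_simp

omit [Fintype F] [DecidableEq F] in
lemma appellF4_summand_dilate (A B C : MulChar F ℂ) (θ : AddChar F ℂ) (X Y w t c e : Fˣ) :
    A (c * w : Fˣ) * θ (c * w : Fˣ) * (B (e * t : Fˣ) * θ (e * t : Fˣ)) *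
        ((C⁻¹ c * θ (c + (c⁻¹ * (c * w * (e * t) * X) : Fˣ))) *
          (B⁻¹ e * θ (e + (e⁻¹ * (c * w * (e * t) * Y) : Fˣ)))) =
      A w * B t * ((A * C⁻¹) c * θ (c * (1 + w + w * t * Y))) *
        θ (e * (1 + t + t * (w * X))) := by
  have h1 : c⁻¹ * (c * w * (e * t) * X) = e * (t * (w * X)) := by
    rw [inv_mul_eq_iff_eq_mul]
    ac_rfl
  have h2 : e⁻¹ * (c * w * (e * t) * Y) = c * (w * t * Y) := by
    rw [inv_mul_eq_iff_eq_mul]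
    ac_rfl
  have hB : B e * B⁻¹ e = 1 := by
    rw [inv_mulChar_apply, mul_inv_cancel₀ (mulChar_units_ne_zero B e)]
  rw [h1, h2]
  simp only [Units.val_mul, map_mul, mul_add, mul_one, AddChar.map_add_eq_mul, MulChar.mul_apply]
  linear_combination (A c * A w * B t * C⁻¹ c * θ (c * w) * θ (e * t) * θ c * θ e *
    θ (e * (t * (w * X))) * θ (c * (w * t * Y))) * hB

/-- The double character sum defining `F₄*(A; B; C, B)`, reduced to a single sum. -/
lemma sum_appellF4_eq (A B C : MulChar F ℂ) (hB : B ≠ 1) (hAC : A * C⁻¹ ≠ 1)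
    {θ : AddChar F ℂ} (hθ : θ.IsPrimitive) (X Y : Fˣ) :
    ∑ ψ : MulChar F ℂ, ∑ χ : MulChar F ℂ,
      gaussSum (A * χ * ψ) θ * gaussSum (B * χ * ψ) θ * gaussSum (C * ψ)⁻¹ θ *
        gaussSum (B * χ)⁻¹ θ * gaussSum ψ⁻¹ θ * gaussSum χ⁻¹ θ * (ψ X * χ Y) =
    ((Fintype.card F : ℂ) - 1) ^ 2 * (Fintype.card F * gaussSum (A * C⁻¹) θ *
      (∑ w : Fˣ, A w * B⁻¹ (-(1 + w * X)) *
        (A * C⁻¹)⁻¹ (1 + w + w * -(1 + w * X : F)⁻¹ * Y)) -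
      gaussSum C⁻¹ θ * gaussSum (A * B⁻¹) θ * (gaussSum B θ * B⁻¹ Y)) := by
  have h := sum_sum_mulChar_separate
    (fun i : Fˣ × Fˣ ↦ A i.1 * θ i.1 * (B i.2 * θ i.2))
    (fun i ↦ i.1 * i.2 * X) (fun i ↦ i.1 * i.2 * Y)
    (fun ψ : MulChar F ℂ ↦ gaussSum (C * ψ)⁻¹ θ * gaussSum ψ⁻¹ θ)
    (fun ψ : MulChar F ℂ ↦ gaussSum (B * ψ)⁻¹ θ * gaussSum ψ⁻¹ θ)
  simp only [sum_gaussSum_inv_mul_gaussSum_inv] at h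
  calc _ = _ := by
        refine Finset.sum_congr rfl fun ψ _ ↦ Finset.sum_congr rfl fun χ _ ↦ ?_
        have e : ∑ i : Fˣ × Fˣ, A i.1 * θ i.1 * (B i.2 * θ i.2) *
            (ψ (i.1 * i.2 * X : Fˣ) * χ (i.1 * i.2 * Y : Fˣ)) =
            gaussSum (A * χ * ψ) θ * gaussSum (B * χ * ψ) θ * (ψ X * χ Y) := by
          rw [gaussSum_eq_sum_units, gaussSum_eq_sum_units, Finset.sum_mul_sum,
            Fintype.sum_prod_type, Finset.sum_mul]
          refine Finset.sum_congr rfl fun u _ ↦ ?_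
          rw [Finset.sum_mul]
          refine Finset.sum_congr rfl fun v _ ↦ ?_
          simp only [Units.val_mul, map_mul, MulChar.mul_apply]
          ring
        refine Eq.trans ?_ (congrArg (· * ((gaussSum (C * ψ)⁻¹ θ * gaussSum ψ⁻¹ θ) *
          (gaussSum (B * χ)⁻¹ θ * gaussSum χ⁻¹ θ))) e.symm)
        ring
    _ = _ := h
    _ = ((Fintype.card F : ℂ) - 1) ^ 2 * ∑ a : Fˣ, ∑ b : Fˣ, ∑ c : Fˣ, ∑ e : Fˣ,
          A a * θ a * (B b * θ b) * ((C⁻¹ c * θ (c + (c⁻¹ * (a * b * X) : Fˣ))) *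
            (B⁻¹ e * θ (e + (e⁻¹ * (a * b * Y) : Fˣ)))) := by
        rw [Fintype.sum_prod_type, Finset.mul_sum]
        refine Finset.sum_congr rfl fun a _ ↦ ?_
        rw [Finset.mul_sum]
        refine Finset.sum_congr rfl fun b _ ↦ ?_
        simp_rw [← Finset.mul_sum, ← Finset.sum_mul]
        ring
    _ = ((Fintype.card F : ℂ) - 1) ^ 2 * ∑ w : Fˣ, ∑ t : Fˣ, ∑ c : Fˣ,
          A w * B t * ((A * C⁻¹) c * θ (c * (1 + w + w * t * Y))) *
            ((if (1 + t + t * (w * X) : F) = 0 then (Fintype.card F : ℂ) else 0) - 1) := by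
        rw [sum_units_quadruple_dilate]
        congr 1
        refine Finset.sum_congr rfl fun w _ ↦ Finset.sum_congr rfl fun t _ ↦
          Finset.sum_congr rfl fun c _ ↦ ?_
        rw [← sum_units_addChar hθ, Finset.mul_sum]
        refine Finset.sum_congr rfl fun e _ ↦ ?_
        exact appellF4_summand_dilate A B C θ X Y w t c e
    _ = ((Fintype.card F : ℂ) - 1) ^ 2 * ((∑ w : Fˣ, ∑ t : Fˣ,
          A w * B t * (gaussSum (A * C⁻¹) θ * (A * C⁻¹)⁻¹ (1 + w + w * t * Y)) *
            (if (1 + t + t * (w * X) : F) = 0 then (Fintype.card F : ℂ) else 0)) -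
          ∑ w : Fˣ, ∑ t : Fˣ, ∑ c : Fˣ,
            A w * B t * ((A * C⁻¹) c * θ (c * (1 + w + w * t * Y)))) := by
        congr 1
        simp_rw [← sum_units_mulChar_mul_addChar _ hAC, mul_sub, Finset.sum_sub_distrib,
          Finset.mul_sum, Finset.sum_mul, mul_one]
    _ = _ := by
        rw [sum_units_triple_eq A B C hB]
        congr 2
        rw [Finset.mul_sum]
        refine Finset.sum_congr rfl fun w _ ↦ ?_
        have h3 := sum_units_mul_ite B (fun t ↦ A w * (gaussSum (A * C⁻¹) θ *
          (A * C⁻¹)⁻¹ (1 + w + w * t * Y))) (w * X)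
        refine Eq.trans (Finset.sum_congr rfl fun t _ ↦ ?_) (h3.trans ?_)
        · ring
        · ring

/-- The Möbius substitution `w = d v / (1 + x v)` relating the integrals of `F₄*` and `F₁*`. -/
lemma sum_units_moebius (A B C : MulChar F ℂ) {x y d : F} (hd : d = (1 - x) * (1 - y))
    (hd0 : d ≠ 0) :
    ∑ w : Fˣ, A w * B⁻¹ (-(1 + w * (-x / d))) *
        (A * C⁻¹)⁻¹ (1 + w + w * -(1 + w * (-x / d))⁻¹ * (-y / d)) =
      B (-1) * A d * ∑ v : Fˣ, A v * (A * C⁻¹)⁻¹ (1 + v) * (B⁻¹ * C)⁻¹ (1 + x * v) *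
        (A * C⁻¹)⁻¹ (1 + x * y * v) := by
  rw [← sum_eq_sum_units_of_zero (f := fun w ↦ A w * B⁻¹ (-(1 + w * (-x / d))) *
        (A * C⁻¹)⁻¹ (1 + w + w * -(1 + w * (-x / d))⁻¹ * (-y / d))) (by simp [MulChar.map_zero]),
    ← sum_eq_sum_units_of_zero (f := fun v ↦ A v * (A * C⁻¹)⁻¹ (1 + v) *
        (B⁻¹ * C)⁻¹ (1 + x * v) * (A * C⁻¹)⁻¹ (1 + x * y * v)) (by simp [MulChar.map_zero]),
    Finset.mul_sum]
  rw [← Finset.sum_filter_of_ne (p := fun w : F ↦ d - x * w ≠ 0)]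
  · symm
    rw [← Finset.sum_filter_of_ne (p := fun v : F ↦ 1 + x * v ≠ 0)]
    · refine Finset.sum_nbij' (fun v ↦ d * v / (1 + x * v)) (fun w ↦ w / (d - x * w)) ?_ ?_ ?_ ?_ ?_
      · intro v hv
        have hv : 1 + x * v ≠ 0 := by simpa using hv
        have hv' : 1 + v * x ≠ 0 := mul_comm x v ▸ hv
        have h : d - x * (d * v / (1 + x * v)) = d / (1 + x * v) := by
          field_simp
          ring
        simp [h, hd0, hv]
      · intro w hw
        have hw : d - x * w ≠ 0 := by simpa using hw
        have hw' : d - w * x ≠ 0 := mul_comm x w ▸ hw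
        have h : 1 + x * (w / (d - x * w)) = d / (d - x * w) := by
          field_simp
          ring
        simp [h, hd0, hw]
      · intro v hv
        have hv : 1 + x * v ≠ 0 := by simpa using hv
        have hv' : 1 + v * x ≠ 0 := mul_comm x v ▸ hv
        have h : d - x * (d * v / (1 + x * v)) = d / (1 + x * v) := by
          field_simp
          ring
        simp only [h]
        field_simp
      · intro w hw
        have hw : d - x * w ≠ 0 := by simpa using hw
        have hw' : d - w * x ≠ 0 := mul_comm x w ▸ hw
        have h : 1 + x * (w / (d - x * w)) = d / (d - x * w) := by
          field_simp
          ring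
        simp only [h]
        field_simp
      · intro v hv
        have hv : 1 + x * v ≠ 0 := by simpa using hv
        have hv' : 1 + v * x ≠ 0 := mul_comm x v ▸ hv
        have h : 1 + d * v / (1 + x * v) * (-x / d) = (1 + x * v)⁻¹ := by
          field_simp
          ring
        have h' : 1 + d * v / (1 + x * v) + d * v / (1 + x * v) * -(1 + x * v) * (-y / d) =
            (1 + v) * (1 + x * y * v) * (1 + x * v)⁻¹ := by
          field_simp
          rw [hd]
          ring
        have hA : A (1 + x * v) ≠ 0 := ((IsUnit.mk0 _ hv).map A).ne_zero
        have hA' : A (1 + v * x) ≠ 0 := mul_comm x v ▸ hA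
        have hm : B⁻¹ (-(1 + x * v)⁻¹) = B (-1) * B (1 + x * v) := by
          rw [MulChar.inv_apply', inv_neg, inv_inv, ← map_mul, neg_one_mul]
        have hdiv : A (d * v / (1 + x * v)) = A d * A v * A⁻¹ (1 + x * v) := by
          rw [div_eq_mul_inv, map_mul, map_mul, MulChar.inv_apply']
        have hAC : (A * C⁻¹)⁻¹ (1 + x * v)⁻¹ = A (1 + x * v) * C⁻¹ (1 + x * v) := by
          rw [← MulChar.inv_apply', inv_inv, MulChar.mul_apply]
        simp only [h, inv_inv, h', hm, hdiv, map_mul, hAC]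
        simp only [mul_inv, MulChar.mul_apply, inv_inv, inv_mulChar_apply]
        field_simp
    · intro v _ hv h
      apply hv
      simp [h, MulChar.map_zero]
  · intro w _ hw h
    apply hw
    have h1 : 1 + w * (-x / d) = 0 := by
      field_simp
      linear_combination h
    simp [h1, MulChar.map_zero]

end AppellLemmas

section Gauss

variable {p : ℕ} [Fact p.Prime] {F : Type*} [Field F] [Fintype F] [Algebra (ZMod p) F]

lemma exists_isPrimitive_gaussS_eq {zeta : ℂ} (hzeta : IsPrimitiveRoot zeta p) :
    ∃ θ : AddChar F ℂ, θ.IsPrimitive ∧ ∀ χ, gaussS p F zeta χ = gaussSum χ θ := by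
  refine ⟨(AddChar.zmodChar p hzeta.pow_eq_one).compAddMonoidHom
    (Algebra.trace (ZMod p) F).toAddMonoidHom, ?_, fun χ ↦ rfl⟩
  apply AddChar.IsPrimitive.of_ne_one
  rw [AddChar.ne_one_iff]
  obtain ⟨a, ha⟩ := Algebra.trace_surjective (ZMod p) F 1
  refine ⟨a, ?_⟩
  have h1 := Nat.Prime.one_lt (Fact.out : p.Prime)
  have : Fact (1 < p) := ⟨h1⟩
  simpa [AddChar.zmodChar_apply, ha, ZMod.val_one] using hzeta.ne_one h1

omit [Fact p.Prime] [Algebra (ZMod p) F] in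
lemma gaussSum_ne_zero {θ : AddChar F ℂ} (hθ : θ.IsPrimitive) (χ : MulChar F ℂ) :
    gaussSum χ θ ≠ 0 := by
  rcases eq_or_ne χ 1 with rfl | hχ
  · rw [gaussSum_one_left]
    · simp
    · simpa using hθ one_ne_zero
  · exact gaussSum_ne_zero_of_nontrivial (by simp) hχ hθ

omit [Fact p.Prime] [Algebra (ZMod p) F] in
lemma gaussSum_mul_gaussSum_inv {θ : AddChar F ℂ} (hθ : θ.IsPrimitive) {χ : MulChar F ℂ}
    (hχ : χ ≠ 1) : gaussSum χ θ * gaussSum χ⁻¹ θ = χ (-1) * Fintype.card F := by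
  rw [← gaussSum_mul_gaussSum_eq_card hχ hθ, ← mul_gaussSum_inv_eq_gaussSum χ⁻¹ θ,
    MulChar.inv_apply', inv_neg, inv_one]
  ring

end Gauss

theorem stmt3    (p : ℕ) [Fact p.Prime] (hp : p ≠ 2) (F : Type*) [Field F] [Fintype F]
    [Algebra (ZMod p) F] (zeta : ℂ) (hzeta : IsPrimitiveRoot zeta p)
    (A B C : MulChar F ℂ) (hB : B ≠ 1) (hAB : A ≠ B) (hBC : B ≠ C) (hCA : C ≠ A)
    (x y : F) (hx0 : x ≠ 0) (hy0 : y ≠ 0) (hx : x ≠ 1) (hy : y ≠ 1) :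
    appellF4star p F zeta A B C B
        (-x / ((1 - x) * (1 - y))) (-y / ((1 - x) * (1 - y))) =
    A ((1 - x) * (1 - y)) * appellF1star p F zeta A (B⁻¹ * C) (A * C⁻¹) C x (x * y) -
      gaussS p F zeta (B) * gaussS p F zeta (A * B⁻¹) / ((Fintype.card F : ℂ) * gaussS p F zeta (A)) *
        (B⁻¹ y * B ((1 - x) * (1 - y))) := by
  classical
  obtain ⟨θ, hθ, hg⟩ := exists_isPrimitive_gaussS_eq (F := F) hzeta
  have hAC : A * C⁻¹ ≠ 1 := fun h ↦ hCA (mul_inv_eq_one.mp h).symm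
  have hBC' : B⁻¹ * C ≠ 1 := fun h ↦ hBC (inv_mul_eq_one.mp h)
  obtain ⟨d, hd⟩ : ∃ d, d = (1 - x) * (1 - y) := ⟨_, rfl⟩
  have hd0 : d ≠ 0 := hd ▸ mul_ne_zero (sub_ne_zero.mpr hx.symm) (sub_ne_zero.mpr hy.symm)
  have hq : (Fintype.card F : ℂ) ≠ 0 := by simp
  have hq1 : (Fintype.card F : ℂ) - 1 ≠ 0 := by
    rw [sub_ne_zero]
    exact_mod_cast (Fintype.one_lt_card (α := F)).ne'
  have h4 := sum_appellF4_eq A B C hB hAC hθ (Units.mk0 (-x / d) (by simp [hx0, hd0]))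
    (Units.mk0 (-y / d) (by simp [hy0, hd0]))
  have h1 := sum_appellF1_eq A (B⁻¹ * C) (A * C⁻¹) C hBC' hAC hAC θ (Units.mk0 x hx0)
    (Units.mk0 (x * y) (mul_ne_zero hx0 hy0))
  simp only [Units.val_mk0, sum_units_moebius A B C hd hd0] at h4 h1
  have hY : B⁻¹ (-y / d) = B (-1) * B⁻¹ y * B d := by
    rw [div_eq_mul_inv, neg_eq_neg_one_mul, map_mul, map_mul, ← MulChar.inv_apply' B⁻¹, inv_inv,
      MulChar.inv_apply', inv_neg, inv_one]
  have hBB := gaussSum_mul_gaussSum_inv hθ hB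
  rw [hY] at h4
  simp only [appellF4star, appellF1star, hg, ← hd, div_mul_eq_mul_div, ← Finset.sum_div]
  rw [h4, h1]
  have gA := gaussSum_ne_zero hθ A
  have gC := gaussSum_ne_zero hθ C⁻¹
  have gAC := gaussSum_ne_zero hθ (A * C⁻¹)
  have gBC := gaussSum_ne_zero hθ (B⁻¹ * C)
  have hB1 : B (-1) ≠ 0 := (isUnit_one.neg.map B).ne_zero
  have hden : gaussSum A θ * gaussSum B θ * gaussSum C⁻¹ θ * gaussSum B⁻¹ θ =
      gaussSum A θ * gaussSum C⁻¹ θ * (B (-1) * Fintype.card F) := by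
    linear_combination gaussSum A θ * gaussSum C⁻¹ θ * hBB
  rw [hden]
  generalize (∑ v : Fˣ, A v * (A * C⁻¹)⁻¹ (1 + v) * (B⁻¹ * C)⁻¹ (1 + x * v) *
        (A * C⁻¹)⁻¹ (1 + x * y * v)) = S
  field_simp
end

section
/- Let A be a multiplicative character on F_q and let x ∈ F_q with x ≠ 0 and x ≠ 1. Then Ā(1-x) = (1/(q-1)) · Σ_{χ over all multiplicative characters of F_q} [g(Aχ)g(χ̄)/g(A)] · χ(-x). -/
/-- The additive character `addCharTheta` attached to a `p`-th root of unity. -/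
noncomputable def traceAddChar (p : ℕ) [NeZero p] (F : Type*) [Field F] [Algebra (ZMod p) F]
    {zeta : ℂ} (hzeta : zeta ^ p = 1) : AddChar F ℂ :=
  (AddChar.zmodChar p hzeta).compAddMonoidHom (Algebra.trace (ZMod p) F).toAddMonoidHom

lemma gaussS_eq_gaussSum (p : ℕ) [NeZero p] (F : Type*) [Field F] [Fintype F]
    [Algebra (ZMod p) F] {zeta : ℂ} (hzeta : zeta ^ p = 1) (χ : MulChar F ℂ) :
    gaussS p F zeta χ = gaussSum χ (traceAddChar p F hzeta) :=
  rfl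

lemma traceAddChar_ne_one (p : ℕ) [Fact p.Prime] (F : Type*) [Field F] [Finite F]
    [Algebra (ZMod p) F] {zeta : ℂ} (hzeta : IsPrimitiveRoot zeta p) :
    traceAddChar p F hzeta.pow_eq_one ≠ 1 := by
  obtain ⟨a, ha⟩ := Algebra.trace_surjective (ZMod p) F 1
  refine AddChar.ne_one_iff.mpr ⟨a, fun h ↦ one_ne_zero (α := ZMod p) ?_⟩
  have hprim := AddChar.zmodChar_primitive_of_primitive_root p hzeta
  refine (hprim.zmod_char_eq_one_iff p 1).mp ?_
  rw [← ha]
  exact h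

namespace MulChar

variable {F : Type*} [Field F] [Fintype F]

lemma sum_apply_eq_ite [DecidableEq F] (a : F) :
    ∑ χ : MulChar F ℂ, χ a = if a = 1 then (Fintype.card F : ℂ) - 1 else 0 := by
  split_ifs with ha
  · have h : Fintype.card (MulChar F ℂ) = Fintype.card F - 1 := by
      rw [← Nat.card_eq_fintype_card, card_eq_card_units_of_hasEnoughRootsOfUnity,
        Nat.card_eq_fintype_card, Fintype.card_units]
    simp [ha, h, Nat.cast_sub (Fintype.card_pos (α := F))]
  · obtain ⟨χ, hχ⟩ := exists_apply_ne_one_of_hasEnoughRootsOfUnity F ℂ ha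
    refine eq_zero_of_mul_eq_self_left hχ ?_
    simp only [Finset.mul_sum, ← mul_apply]
    exact Fintype.sum_bijective _ (Group.mulLeft_bijective χ) _ _ fun _ ↦ rfl

end MulChar

lemma gaussSum_ne_zero_s5 {F : Type*} [Field F] [Fintype F] (χ : MulChar F ℂ) {ψ : AddChar F ℂ}
    (hψ : ψ ≠ 1) : gaussSum χ ψ ≠ 0 := by
  obtain rfl | hχ := eq_or_ne χ 1
  · simp [gaussSum_one_left hψ]
  · exact gaussSum_ne_zero_of_nontrivial (by simp) hχ (AddChar.IsPrimitive.of_ne_one hψ)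

/-- Expansion of `A⁻¹ (1 - x)` in multiplicative characters, cleared of denominators. -/
lemma sum_gaussSum_mul_gaussSum_inv_s5 {F : Type*} [Field F] [Fintype F] (A : MulChar F ℂ)
    (ψ : AddChar F ℂ) {x : F} (hx0 : x ≠ 0) (hx1 : x ≠ 1) :
    ∑ χ : MulChar F ℂ, gaussSum (A * χ) ψ * gaussSum χ⁻¹ ψ * χ (-x) =
      ((Fintype.card F : ℂ) - 1) * (A⁻¹ (1 - x) * gaussSum A ψ) := by
  classical
  have hshift := gaussSum_mulShift_eq A ψ (Units.mk0 (1 - x) (sub_ne_zero.mpr hx1.symm))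
  rw [Units.val_mk0] at hshift
  have horth (a b : F) (ha : a ≠ 0) :
      ∑ χ : MulChar F ℂ, χ (a * b⁻¹ * -x) =
        if b = -x * a then (Fintype.card F : ℂ) - 1 else 0 := by
    rw [MulChar.sum_apply_eq_ite]
    refine if_congr ?_ rfl rfl
    obtain rfl | hb := eq_or_ne b 0
    · simp [ha, hx0]
    · field_simp
      constructor <;> intro h <;> linear_combination -h
  calc ∑ χ : MulChar F ℂ, gaussSum (A * χ) ψ * gaussSum χ⁻¹ ψ * χ (-x)
      = ∑ χ : MulChar F ℂ, ∑ a, ∑ b, A a * ψ (a + b) * χ (a * b⁻¹ * -x) := by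
        refine Finset.sum_congr rfl fun χ _ ↦ ?_
        rw [gaussSum, gaussSum, Finset.sum_mul_sum]
        simp only [Finset.sum_mul, MulChar.mul_apply, MulChar.inv_apply', map_mul,
          AddChar.map_add_eq_mul]
        exact Finset.sum_congr rfl fun a _ ↦ Finset.sum_congr rfl fun b _ ↦ by ring
    _ = ∑ a, ∑ b, A a * ψ (a + b) * ∑ χ : MulChar F ℂ, χ (a * b⁻¹ * -x) := by
        rw [Finset.sum_comm]
        refine Finset.sum_congr rfl fun a _ ↦ ?_
        rw [Finset.sum_comm]
        simp only [Finset.mul_sum]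
    _ = ∑ a, A a * ψ ((1 - x) * a) * ((Fintype.card F : ℂ) - 1) := by
        refine Finset.sum_congr rfl fun a _ ↦ ?_
        obtain rfl | ha := eq_or_ne a 0
        · simp [MulChar.map_zero A]
        · simp only [horth a _ ha, mul_ite, mul_zero, Finset.sum_ite_eq', Finset.mem_univ, if_true]
          congr 3
          ring
    _ = ((Fintype.card F : ℂ) - 1) * (A⁻¹ (1 - x) * gaussSum A ψ) := by
        rw [← hshift, ← Finset.sum_mul, mul_comm]
        rfl

theorem stmt5    (p : ℕ) [Fact p.Prime] (hp : p ≠ 2) (F : Type*) [Field F] [Fintype F]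
    [Algebra (ZMod p) F] (zeta : ℂ) (hzeta : IsPrimitiveRoot zeta p)
    (A : MulChar F ℂ) (x : F) (hx0 : x ≠ 0) (hx1 : x ≠ 1) :
    A⁻¹ (1 - x) =
    (1 / ((Fintype.card F : ℂ) - 1)) * ∑ χ : MulChar F ℂ,
      gaussS p F zeta (A * χ) * gaussS p F zeta (χ⁻¹) / gaussS p F zeta (A) * χ (-x) := by
  have hg : gaussSum A (traceAddChar p F hzeta.pow_eq_one) ≠ 0 :=
    gaussSum_ne_zero_s5 A (traceAddChar_ne_one p F hzeta)
  have hq : (Fintype.card F : ℂ) - 1 ≠ 0 :=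
    sub_ne_zero.mpr (mod_cast (Fintype.one_lt_card (α := F)).ne')
  simp only [gaussS_eq_gaussSum p F hzeta.pow_eq_one, div_mul_eq_mul_div, ← Finset.sum_div]
  rw [sum_gaussSum_mul_gaussSum_inv_s5 A _ hx0 hx1]
  field_simp
end
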